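/- arXiv:math/0212354 — 2 statements merged into one kernel-verified Lean document; each statement's English description precedes it below -/
import Mathlib

section
/- Unique positive square root in the even part of the exterior algebra: let Λ be the exterior algebra of ℝⁿ and let ε : Λ → ℝ denote the projection onto the degree-zero (scalar) component. For every element u of the even part of Λ with ε(u) > 0, there exists a unique element v of the even part of Λ with ε(v) > 0 and v·v = u. (This fact makes the product ω * ω′ of differential forms with nonvanishing top-degree components, defined via the square root of the product of the corresponding semidensities, well defined.) -/
noncomputable section

/-- `Λ n`, the exterior algebra of `ℝⁿ`. -/
abbrev Lam (n : ℕ) : Type := ExteriorAlgebra ℝ (Fin n → ℝ)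

namespace ExteriorAlgebra

variable {R M : Type*} [CommRing R] [AddCommGroup M] [Module R M]

theorem ι_mul_ι_comm (a b : M) (x : ExteriorAlgebra R M) :
    Commute (ι R a * ι R b) x := by
  have swap (x y : M) : ι R x * ι R y = -(ι R y * ι R x) :=
    eq_neg_of_add_eq_zero_left (ι_add_mul_swap x y)
  induction x using ExteriorAlgebra.induction with
  | algebraMap r => exact (Algebra.commutes r _).symm
  | ι c =>
    change ι R a * ι R b * ι R c = ι R c * (ι R a * ι R b)
    rw [mul_assoc, swap b c, mul_neg, ← mul_assoc, swap a c, neg_mul, neg_neg, mul_assoc]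
  | mul x y hx hy => exact hx.mul_right hy
  | add x y hx hy => exact hx.add_right hy

theorem ι_mul_ι_mul_self (a b : M) : ι R a * ι R b * (ι R a * ι R b) = 0 := by
  rw [mul_assoc, ← mul_assoc (ι R b), (ι_mul_ι_comm b a (ι R b)).eq, ← mul_assoc (ι R b),
    ι_sq_zero, zero_mul, mul_zero]

theorem commute_of_mem_evenOdd_zero {x : ExteriorAlgebra R M}
    (hx : x ∈ CliffordAlgebra.evenOdd (0 : QuadraticForm R M) 0) (y : ExteriorAlgebra R M) :
    Commute x y := by
  induction x, hx using CliffordAlgebra.even_induction with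
  | algebraMap r => exact Algebra.commutes r _
  | add x z _ _ hx hz => exact hx.add_left hz
  | ι_mul_ι_mul a b x _ hx => exact (ι_mul_ι_comm a b y).mul_left hx

theorem isNilpotent_sub_algebraMap_of_mem_evenOdd_zero {x : ExteriorAlgebra R M}
    (hx : x ∈ CliffordAlgebra.evenOdd (0 : QuadraticForm R M) 0) :
    IsNilpotent (x - algebraMap R (ExteriorAlgebra R M) (algebraMapInv x)) := by
  induction x, hx using CliffordAlgebra.even_induction with
  | algebraMap r =>
    rw [algebraMap_leftInverse M r, sub_self]
    exact IsNilpotent.zero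
  | add x y hx hy ihx ihy =>
    rw [map_add, map_add, add_sub_add_comm]
    exact ((commute_of_mem_evenOdd_zero hx _).sub_left (Algebra.commutes _ _)).isNilpotent_add
      ihx ihy
  | ι_mul_ι_mul a b x _ _ =>
    have hι : algebraMapInv (ι R a) = 0 := by simp [algebraMapInv]
    have hε : algebraMapInv (ι R a * ι R b * x) = 0 := by
      rw [map_mul, map_mul, hι, zero_mul, zero_mul]
    refine ⟨2, ?_⟩
    erw [hε]
    rw [map_zero, sub_zero]
    exact ((ι_mul_ι_comm a b x).mul_pow 2).trans (by
      rw [sq (ι R a * ι R b), ι_mul_ι_mul_self, zero_mul])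

/-- The even part of the exterior algebra is commutative. -/
abbrev evenCommRing : CommRing (CliffordAlgebra.even (0 : QuadraticForm R M)) where
  mul_comm x y := Subtype.ext (commute_of_mem_evenOdd_zero x.2 y)

end ExteriorAlgebra

/-- unique positive square root in the even part of the exterior algebra:
every even element `u` with positive scalar (degree-zero) component `ε u` has a unique
even square root with positive scalar component. -/
theorem existsUnique_even_sqrt (n : ℕ) (u : Lam n)
    (hu : u ∈ CliffordAlgebra.evenOdd (0 : QuadraticForm ℝ (Fin n → ℝ)) 0)
    (hupos : 0 < ExteriorAlgebra.algebraMapInv u) :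
    ∃! v : Lam n,
      v ∈ CliffordAlgebra.evenOdd (0 : QuadraticForm ℝ (Fin n → ℝ)) 0 ∧
        0 < ExteriorAlgebra.algebraMapInv v ∧ v * v = u := by
  let A := CliffordAlgebra.even (0 : QuadraticForm ℝ (Fin n → ℝ))
  let ε : Lam n →ₐ[ℝ] ℝ := ExteriorAlgebra.algebraMapInv
  let : CommRing A := ExteriorAlgebra.evenCommRing
  have nilp (x : A) : IsNilpotent (algebraMap ℝ A (ε x) - x) := by
    rw [← neg_sub, isNilpotent_neg_iff]
    obtain ⟨k, hk⟩ := ExteriorAlgebra.isNilpotent_sub_algebraMap_of_mem_evenOdd_zero x.2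
    exact ⟨k, Subtype.ext hk⟩
  let u' : A := ⟨u, hu⟩
  let c := algebraMap ℝ A (√(ε u))
  let P : Polynomial A := Polynomial.X ^ 2 - Polynomial.C u'
  have hP (r : A) : Polynomial.aeval r P = r * r - u' := by simp [P, sq]
  have hc : c * c = algebraMap ℝ A (ε u) := by
    rw [← map_mul, Real.mul_self_sqrt hupos.le]
  have hroot : IsNilpotent (Polynomial.aeval c P) := by
    rw [hP, hc]
    exact nilp u'
  have hderiv : IsUnit (Polynomial.aeval c (Polynomial.derivative P)) := by
    have h : Polynomial.aeval c (Polynomial.derivative P) = algebraMap ℝ A (2 * √(ε u)) := by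
      rw [map_mul, ← one_add_one_eq_two, map_add, map_one]
      simp [P, c]
    rw [h]
    exact (IsUnit.mk0 _ (mul_pos two_pos (Real.sqrt_pos.2 hupos)).ne').map _
  obtain ⟨v, ⟨hv, hvP⟩, huniq⟩ :=
    Polynomial.existsUnique_nilpotent_sub_and_aeval_eq_zero hroot hderiv
  rw [hP, sub_eq_zero] at hvP
  refine ⟨v, ⟨v.2, ?_, congrArg Subtype.val hvP⟩, ?_⟩
  · have h : IsNilpotent (ε.comp A.val (c - v)) := hv.map _
    have hεc : ε.comp A.val c = √(ε u) := (ε.comp A.val).commutes _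
    rw [map_sub, hεc, isNilpotent_iff_eq_zero, sub_eq_zero] at h
    exact (Real.sqrt_pos.2 hupos).trans_eq h
  · rintro w ⟨hw, hwpos, hwu⟩
    have hεw : √(ε u) = ε w := by
      rw [← hwu, map_mul, Real.sqrt_mul_self hwpos.le]
    refine congrArg Subtype.val (huniq ⟨w, hw⟩ ⟨?_, ?_⟩)
    · simp only [c, hεw]
      exact nilp ⟨w, hw⟩
    · rw [hP, sub_eq_zero]
      exact Subtype.ext hwu
end
end

section
/- Derived bracket Leibniz (Jacobi) identity: let R be a commutative ring, L a Lie algebra over R, and D : L → L an R-linear derivation of the Lie bracket (D⁅a,b⁆ = ⁅Da,b⁆ + ⁅a,Db⁆ for all a,b) satisfying D ∘ D = 0. Define the derived bracket ⟦a,b⟧ := ⁅Da, b⁆. Then for all a, b, c ∈ L: ⟦a,⟦b,c⟧⟧ = ⟦⟦a,b⟧,c⟧ + ⟦b,⟦a,c⟧⟧. (This is the even-algebra form of the statement that the derived bracket {f,g} = {f,{S,g}} satisfies the Jacobi identity precisely because the master Hamiltonian S satisfies {S,S} = 0, i.e., D = {S,·} squares to zero.) -/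
/-- the derived bracket `⟦a,b⟧ := ⁅Da, b⁆` of a square-zero Lie derivation
`D` satisfies the Leibniz (Jacobi) identity `⟦a,⟦b,c⟧⟧ = ⟦⟦a,b⟧,c⟧ + ⟦b,⟦a,c⟧⟧`. -/
theorem derived_bracket_jacobi (R : Type*) (L : Type*) [CommRing R] [LieRing L]
    [LieAlgebra R L] (D : LieDerivation R L L) (hD : ∀ a, D (D a) = 0) (a b c : L) :
    ⁅D a, ⁅D b, c⁆⁆ = ⁅D ⁅D a, b⁆, c⁆ + ⁅D b, ⁅D a, c⁆⁆ := by
  rw [LieDerivation.apply_lie_eq_add, hD, zero_lie, add_zero, leibniz_lie]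
end
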